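/- Let λ ≥ 0 and t ∈ (√2/2, 1] with 4(1+λ)t² − (1+λ)²(4t²−1) ≠ 0, let f ∈ H_Σ(λ,t) have Taylor coefficients aₙ = f⁽ⁿ⁾(0)/n!, and let μ ∈ ℝ. If |μ − 1| ≥ (1/(8(1+2λ)))·|(1+λ)²/t² − 4λ(1+λ)|, then |a₃ − μ·a₂²| ≤ 8|1−μ|t³ / |4(1+λ)t² − (1+λ)²(4t²−1)|. -/

import Mathlib

/-- The open unit disk in ℂ. -/
def unitD : Set ℂ := {z : ℂ | ‖z‖ < 1}

/-- The generating function `H(z,t) = 1 / (1 - 2 t z + z²)`. -/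
noncomputable def Hker (t : ℝ) (z : ℂ) : ℂ := 1 / (1 - 2 * (t : ℂ) * z + z ^ 2)

/-- `F` is subordinate to `H(·, t)` on the unit disk. -/
def SubordH (t : ℝ) (F : ℂ → ℂ) : Prop :=
  ∃ ω : ℂ → ℂ, AnalyticOnNhd ℂ ω unitD ∧ ω 0 = 0 ∧ (∀ z ∈ unitD, ‖ω z‖ < 1) ∧
    ∀ z ∈ unitD, F z = Hker t (ω z)

/-- The expression `(1-λ) z f'(z)/f(z) + λ (1 + z f''(z)/f'(z))`. -/
noncomputable def exprH (lam : ℝ) (f : ℂ → ℂ) (z : ℂ) : ℂ :=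
  (1 - (lam : ℂ)) * (z * deriv f z / f z) +
    (lam : ℂ) * (1 + z * deriv (deriv f) z / deriv f z)

/-- The analytic extension (with value 1 at 0) of `exprH lam f` is subordinate to `H(·,t)`. -/
def SubordExprH (lam t : ℝ) (f : ℂ → ℂ) : Prop :=
  ∃ F : ℂ → ℂ, AnalyticOnNhd ℂ F unitD ∧ F 0 = 1 ∧
    (∀ z ∈ unitD, z ≠ 0 → F z = exprH lam f z) ∧ SubordH t F

/-- `f` is bi-univalent on the unit disk with (bi-univalent) inverse `g`. -/
def BiUnivalentWithInv (f g : ℂ → ℂ) : Prop :=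
  AnalyticOnNhd ℂ f unitD ∧ f 0 = 0 ∧ deriv f 0 = 1 ∧ Set.InjOn f unitD ∧
  AnalyticOnNhd ℂ g unitD ∧ Set.InjOn g unitD ∧
  (∀ z ∈ unitD, f z ∈ unitD → g (f z) = z) ∧
  (∀ w ∈ unitD, g w ∈ unitD → f (g w) = w)

/-- The class `H_Σ(λ, t)`. -/
def InHSigma (lam t : ℝ) (f : ℂ → ℂ) : Prop :=
  ∃ g : ℂ → ℂ, BiUnivalentWithInv f g ∧ SubordExprH lam t f ∧ SubordExprH lam t g

open Filter Topology

/-- `f z = a + b z + c z² + O(z³)` near `0`, with an analytic remainder factor. -/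
def HasJetTwo (f : ℂ → ℂ) (a b c : ℂ) : Prop :=
  ∃ r : ℂ → ℂ, AnalyticAt ℂ r 0 ∧ ∀ᶠ z in 𝓝 0, f z = a + b * z + c * z ^ 2 + z ^ 3 * r z

namespace HasJetTwo

variable {f g : ℂ → ℂ} {a b c a' b' c' : ℂ}

theorem congr (hf : HasJetTwo f a b c) (h : f =ᶠ[𝓝 0] g) : HasJetTwo g a b c := by
  obtain ⟨r, hr, hfr⟩ := hf
  refine ⟨r, hr, ?_⟩
  filter_upwards [hfr, h] with z h1 h2
  rw [← h2, h1]

theorem const (k : ℂ) : HasJetTwo (fun _ => k) k 0 0 :=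
  ⟨0, analyticAt_const, by simp⟩

theorem add (hf : HasJetTwo f a b c) (hg : HasJetTwo g a' b' c') :
    HasJetTwo (fun z => f z + g z) (a + a') (b + b') (c + c') := by
  obtain ⟨r, hr, hfr⟩ := hf
  obtain ⟨s, hs, hgs⟩ := hg
  refine ⟨fun z => r z + s z, hr.fun_add hs, ?_⟩
  filter_upwards [hfr, hgs] with z h1 h2
  rw [h1, h2]
  ring

theorem mul (hf : HasJetTwo f a b c) (hg : HasJetTwo g a' b' c') :
    HasJetTwo (fun z => f z * g z) (a * a') (a * b' + b * a') (a * c' + b * b' + c * a') := by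
  obtain ⟨r, hr, hfr⟩ := hf
  obtain ⟨s, hs, hgs⟩ := hg
  refine ⟨fun z => (b * c' + c * b') + c * c' * z + (a + b * z + c * z ^ 2) * s z +
    r z * (a' + b' * z + c' * z ^ 2) + z ^ 3 * r z * s z, by fun_prop, ?_⟩
  filter_upwards [hfr, hgs] with z h1 h2
  rw [h1, h2]
  ring

theorem comp (hg : HasJetTwo g a' b' c') (hf : HasJetTwo f 0 b c) :
    HasJetTwo (fun z => g (f z)) a' (b' * b) (b' * c + c' * b ^ 2) := by
  obtain ⟨r, hr, hfr⟩ := hf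
  obtain ⟨s, hs, hgs⟩ := hg
  set F : ℂ → ℂ := fun z => z * (b + c * z + z ^ 2 * r z) with hF
  have hFa : AnalyticAt ℂ F 0 := by fun_prop
  have hF0 : F 0 = 0 := by simp [hF]
  have hsF : AnalyticAt ℂ (fun z => s (F z)) 0 :=
    AnalyticAt.fun_comp (by rwa [hF0]) hFa
  have hFt : Tendsto F (𝓝 0) (𝓝 0) := by simpa [hF0] using hFa.continuousAt.tendsto
  refine ⟨fun z => b' * r z + c' * ((c + z * r z) * (2 * b + c * z + z ^ 2 * r z)) +
    (b + c * z + z ^ 2 * r z) ^ 3 * s (F z), ?_, ?_⟩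
  · exact AnalyticAt.fun_add (by fun_prop) (AnalyticAt.fun_mul (by fun_prop) hsF)
  filter_upwards [hfr, hFt.eventually hgs] with z h1 h2
  have h3 : f z = F z := by rw [h1, hF]; ring
  rw [h3, h2, hF]
  ring

theorem unique (hf : HasJetTwo f a b c) (hg : HasJetTwo f a' b' c') :
    a = a' ∧ b = b' ∧ c = c' := by
  obtain ⟨r, hr, hfr⟩ := hf
  obtain ⟨s, hs, hgs⟩ := hg
  have hr' := hr.continuousAt
  have hs' := hs.continuousAt
  have key : ∀ u v : ℂ → ℂ, ContinuousAt u 0 → ContinuousAt v 0 →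
      (∀ᶠ z in 𝓝[≠] 0, u z = v z) → u 0 = v 0 := by
    intro u v hu hv h
    exact tendsto_nhds_unique_of_eventuallyEq (hu.tendsto.mono_left nhdsWithin_le_nhds)
      (hv.tendsto.mono_left nhdsWithin_le_nhds) h
  have h : ∀ᶠ z in 𝓝[≠] (0 : ℂ), z ≠ 0 ∧
      a + b * z + c * z ^ 2 + z ^ 3 * r z = a' + b' * z + c' * z ^ 2 + z ^ 3 * s z := by
    filter_upwards [self_mem_nhdsWithin, nhdsWithin_le_nhds hfr, nhdsWithin_le_nhds hgs]
      with z h0 h1 h2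
    exact ⟨h0, h1.symm.trans h2⟩
  have ha : a = a' := by
    simpa using key (fun z => a + b * z + c * z ^ 2 + z ^ 3 * r z)
      (fun z => a' + b' * z + c' * z ^ 2 + z ^ 3 * s z) (by fun_prop) (by fun_prop)
      (h.mono fun z hz => hz.2)
  subst ha
  have hb : b = b' := by
    have hbz := key (fun z => b + c * z + z ^ 2 * r z)
      (fun z => b' + c' * z + z ^ 2 * s z) (by fun_prop) (by fun_prop)
      (h.mono fun z hz => mul_left_cancel₀ hz.1 (by linear_combination hz.2))
    simpa using hbz
  subst hb
  refine ⟨rfl, rfl, ?_⟩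
  have hcz := key (fun z => c + z * r z) (fun z => c' + z * s z) (by fun_prop) (by fun_prop)
    (h.mono fun z hz => mul_left_cancel₀ (pow_ne_zero 2 hz.1) (by linear_combination hz.2))
  simpa using hcz

end HasJetTwo

theorem AnalyticAt.hasJetTwo {f : ℂ → ℂ} (hf : AnalyticAt ℂ f 0) :
    HasJetTwo f (f 0) (iteratedDeriv 1 f 0) (iteratedDeriv 2 f 0 / 2) := by
  obtain ⟨r, hr, h⟩ := hf.exists_eventuallyEq_sum_add_pow_mul 3
  refine ⟨r, hr, ?_⟩
  filter_upwards [h] with z hz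
  rw [hz]
  simp [Finset.sum_range_succ]
  ring

theorem isOpen_unitD : IsOpen unitD :=
  isOpen_lt continuous_norm continuous_const

theorem zero_mem_unitD : (0 : ℂ) ∈ unitD := by simp [unitD]

/-- A bounded-by-one analytic function on the disk has second Taylor coefficient at most one. -/
theorem norm_iteratedDeriv_two_div_two_le {ω : ℂ → ℂ} (hω : AnalyticOnNhd ℂ ω unitD)
    (hb : ∀ z ∈ unitD, ‖ω z‖ < 1) : ‖iteratedDeriv 2 ω 0 / 2‖ ≤ 1 := by
  have h : ∀ R ∈ Set.Ioo (0 : ℝ) 1, ‖iteratedDeriv 2 ω 0 / 2‖ * R ^ 2 ≤ 1 := by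
    rintro R ⟨hR0, hR1⟩
    have hsub : Metric.closedBall (0 : ℂ) R ⊆ unitD := fun z hz =>
      lt_of_le_of_lt (by simpa using hz) hR1
    have hd : DiffContOnCl ℂ ω (Metric.ball 0 R) :=
      DifferentiableOn.diffContOnCl_ball (hω.differentiableOn.mono hsub) le_rfl
    have := Complex.norm_iteratedDeriv_le_of_forall_mem_sphere_norm_le 2 hR0 hd (C := 1)
      fun z hz => (hb z (hsub (Metric.sphere_subset_closedBall hz))).le
    rw [le_div_iff₀ (by positivity)] at this
    norm_num at this ⊢
    linarith
  have hlim : Tendsto (fun R : ℝ => ‖iteratedDeriv 2 ω 0 / 2‖ * R ^ 2) (𝓝[<] 1)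
      (𝓝 (‖iteratedDeriv 2 ω 0 / 2‖ * 1 ^ 2)) :=
    ((by fun_prop : Continuous fun R : ℝ => ‖iteratedDeriv 2 ω 0 / 2‖ * R ^ 2).tendsto
      1).mono_left nhdsWithin_le_nhds
  have := le_of_tendsto hlim
    (by filter_upwards [Ioo_mem_nhdsLT (zero_lt_one' ℝ)] with R hR using h R hR)
  simpa using this

/-- A normalized analytic function factors as `z * p z` near `0`, with explicit jet of `p`. -/
theorem AnalyticAt.exists_eq_mul_hasJetTwo {f : ℂ → ℂ} (hf : AnalyticAt ℂ f 0) (h0 : f 0 = 0) :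
    ∃ p : ℂ → ℂ, (∀ᶠ z in 𝓝 0, f z = z * p z) ∧
      HasJetTwo p (deriv f 0) (iteratedDeriv 2 f 0 / 2) (iteratedDeriv 3 f 0 / 6) ∧
      p 0 = deriv f 0 := by
  obtain ⟨r, hr, h⟩ := hf.exists_eventuallyEq_sum_add_pow_mul 4
  refine ⟨fun z => deriv f 0 + iteratedDeriv 2 f 0 / 2 * z + iteratedDeriv 3 f 0 / 6 * z ^ 2 +
    z ^ 3 * r z, ?_, ⟨r, hr, .of_forall fun z => rfl⟩, by simp⟩
  filter_upwards [h] with z hz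
  rw [hz]
  simp [Finset.sum_range_succ, h0, Nat.factorial]
  ring

/-- Coefficient relations forced by subordination of the `λ`-convex expression to `H(·,t)`. -/
theorem SubordExprH.exists_coeff {lam t : ℝ} {f : ℂ → ℂ} (hs : SubordExprH lam t f)
    (hf : AnalyticAt ℂ f 0) (h0 : f 0 = 0) (h1 : deriv f 0 = 1) {x y : ℂ}
    (hx : iteratedDeriv 2 f 0 / 2 = x) (hy : iteratedDeriv 3 f 0 / 6 = y) :
    ∃ c d : ℂ, ‖d‖ ≤ 1 ∧ 2 * t * c = (1 + lam) * x ∧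
      2 * t * d + (4 * t ^ 2 - 1) * c ^ 2 = 2 * (1 + 2 * lam) * y - (1 + 3 * lam) * x ^ 2 := by
  obtain ⟨F, -, -, hFe, ω, hω, hω0, hωb, hFω⟩ := hs
  obtain ⟨p, hfp, hpj, hp0⟩ := hf.exists_eq_mul_hasJetTwo h0
  have hωa : AnalyticAt ℂ ω 0 := hω 0 zero_mem_unitD
  refine ⟨iteratedDeriv 1 ω 0, iteratedDeriv 2 ω 0 / 2,
    norm_iteratedDeriv_two_div_two_le hω hωb, ?_⟩
  have hωj := hωa.hasJetTwo
  generalize iteratedDeriv 1 ω 0 = c at hωj ⊢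
  generalize iteratedDeriv 2 ω 0 / 2 = d at hωj ⊢
  rw [hω0] at hωj
  rw [h1, hx, hy] at hpj
  rw [h1] at hp0
  have hf'j : HasJetTwo (deriv f) 1 (2 * x) (3 * y) := by
    have := hf.deriv.hasJetTwo
    rw [← iteratedDeriv_succ', ← iteratedDeriv_succ', h1] at this
    convert this using 1
    · rw [← hx]; ring
    · rw [← hy]; ring
  have hf''j : HasJetTwo (fun z => z * deriv (deriv f) z) 0 (2 * x) (6 * y) := by
    obtain ⟨r, hr, h⟩ := hf.deriv.deriv.exists_eventuallyEq_sum_add_pow_mul 2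
    refine ⟨r, hr, ?_⟩
    filter_upwards [h] with z hz
    rw [hz]
    simp only [Finset.sum_range_succ, ← iteratedDeriv_succ']
    simp [← hx, ← hy]
    ring
  have hden : HasJetTwo (fun z => 1 + (-2 * t) * ω z + ω z * ω z)
      _ _ _ := ((HasJetTwo.const 1).add ((HasJetTwo.const (-2 * t)).mul hωj)).add (hωj.mul hωj)
  have hL := hden.mul (((HasJetTwo.const (1 - (lam : ℂ))).mul (hf'j.mul hf'j)).add
    ((HasJetTwo.const (lam : ℂ)).mul ((hpj.mul hf'j).add (hpj.mul hf''j))))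
  have hR := hpj.mul hf'j
  have hf'0 : ∀ᶠ z in 𝓝 0, deriv f z ≠ 0 :=
    hf.deriv.continuousAt.eventually_ne (by simp [h1])
  have hpc : ∀ᶠ z in 𝓝 0, p z ≠ 0 := by
    obtain ⟨r, hr, h⟩ := hpj
    have hr' := hr.continuousAt
    have hc : ContinuousAt (fun z => 1 + x * z + y * z ^ 2 + z ^ 3 * r z) 0 := by fun_prop
    filter_upwards [h, hc.eventually_ne (y := 0) (by simp)] with z h1 h2
    rwa [h1]
  have hden0 : ∀ᶠ z in 𝓝 0, 1 - 2 * (t : ℂ) * ω z + ω z ^ 2 ≠ 0 := by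
    have hωc := hωa.continuousAt
    exact ContinuousAt.eventually_ne (by fun_prop) (by simp [hω0])
  have heq := hL.congr (g := fun z => p z * deriv f z) (by
    filter_upwards [hf'0, hpc, hden0, hfp, isOpen_unitD.mem_nhds zero_mem_unitD]
      with z hz1 hz2 hz3 hz4 hz5
    rcases eq_or_ne z 0 with rfl | hz
    · simp [hω0, hp0, h1]
    have e := (hFe z hz5 hz).symm.trans (hFω z hz5)
    rw [exprH, Hker, hz4] at e
    field_simp at e
    linear_combination e)
  obtain ⟨-, e1, e2⟩ := heq.unique hR
  have e3 : 2 * t * c = (1 + lam) * x := by linear_combination -e1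
  exact ⟨e3, by linear_combination -e2 + (2 * t * c - 3 * x) * e3⟩

theorem BiUnivalentWithInv.inverse_coeff {f g : ℂ → ℂ} (h : BiUnivalentWithInv f g) :
    g 0 = 0 ∧ deriv g 0 = 1 ∧ iteratedDeriv 2 g 0 / 2 = -(iteratedDeriv 2 f 0 / 2) ∧
      iteratedDeriv 3 g 0 / 6 = 2 * (iteratedDeriv 2 f 0 / 2) ^ 2 - iteratedDeriv 3 f 0 / 6 := by
  obtain ⟨hf, hf0, hf1, -, hg, -, hgf, -⟩ := h
  have hfa := hf 0 zero_mem_unitD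
  have hg0 : g 0 = 0 := by
    simpa [hf0] using hgf 0 zero_mem_unitD (by rw [hf0]; exact zero_mem_unitD)
  obtain ⟨p, hfp, hpj, hp0⟩ := hfa.exists_eq_mul_hasJetTwo hf0
  obtain ⟨q, hgq, hqj, hq0⟩ := (hg 0 zero_mem_unitD).exists_eq_mul_hasJetTwo hg0
  have hfj := hfa.hasJetTwo
  rw [hf0, iteratedDeriv_one, hf1] at hfj
  rw [hf1] at hpj
  have hft : Tendsto f (𝓝 0) (𝓝 0) := by simpa [hf0] using hfa.continuousAt.tendsto
  have hg1 : deriv g 0 = 1 := by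
    have hcomp : (fun z => g (f z)) =ᶠ[𝓝 0] fun z => z := by
      filter_upwards [isOpen_unitD.mem_nhds zero_mem_unitD,
        hft.eventually (isOpen_unitD.mem_nhds zero_mem_unitD)] with z h1 h2 using hgf z h1 h2
    have hd : HasDerivAt (fun z => g (f z)) (deriv g 0 * deriv f 0) 0 :=
      HasDerivAt.comp 0 (by rw [hf0]; exact (hg 0 zero_mem_unitD).differentiableAt.hasDerivAt)
        hfa.differentiableAt.hasDerivAt
    simpa [hf1] using hd.unique ((hasDerivAt_id' 0).congr_of_eventuallyEq hcomp)
  rw [hg1] at hqj hq0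
  have heq := ((hqj.comp hfj).mul hpj).congr (g := fun _ => 1) (by
    filter_upwards [hfp, hft.eventually hgq, isOpen_unitD.mem_nhds zero_mem_unitD,
      hft.eventually (isOpen_unitD.mem_nhds zero_mem_unitD)] with z h1 h2 h3 h4
    rcases eq_or_ne z 0 with rfl | hz
    · simp [hf0, hq0, hp0, hf1]
    · have := (hgf z h3 h4).symm.trans h2
      rw [h1] at this ⊢
      exact mul_left_cancel₀ hz (by linear_combination -this))
  obtain ⟨-, e1, e2⟩ := heq.unique (HasJetTwo.const 1)
  have e3 : iteratedDeriv 2 g 0 / 2 = -(iteratedDeriv 2 f 0 / 2) := by linear_combination e1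
  refine ⟨hg0, hg1, e3, ?_⟩
  rw [e3] at e2
  linear_combination e2

/-- If `|k| ≤ |h|` then `h (u + v) + k (u - v)` is at most `2 |h|` on the closed bidisk. -/
theorem norm_mul_add_add_mul_sub_le {h k : ℝ} (hkh : |k| ≤ |h|) {u v : ℂ}
    (hu : ‖u‖ ≤ 1) (hv : ‖v‖ ≤ 1) : ‖(h : ℂ) * (u + v) + k * (u - v)‖ ≤ 2 * |h| := by
  have e : (h : ℂ) * (u + v) + k * (u - v) = ((h + k : ℝ) : ℂ) * u + ((h - k : ℝ) : ℂ) * v := by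
    push_cast; ring
  rw [e]
  have hu' : ‖((h + k : ℝ) : ℂ) * u‖ ≤ |h + k| := by
    rw [norm_mul, Complex.norm_real, Real.norm_eq_abs]
    exact mul_le_of_le_one_right (abs_nonneg _) hu
  have hv' : ‖((h - k : ℝ) : ℂ) * v‖ ≤ |h - k| := by
    rw [norm_mul, Complex.norm_real, Real.norm_eq_abs]
    exact mul_le_of_le_one_right (abs_nonneg _) hv
  refine (norm_add_le _ _).trans ((add_le_add hu' hv').trans ?_)
  rcases abs_cases h with ⟨h1, _⟩ | ⟨h1, _⟩ <;> rcases abs_cases (h + k) with ⟨h2, _⟩ | ⟨h2, _⟩ <;>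
    rcases abs_cases (h - k) with ⟨h3, _⟩ | ⟨h3, _⟩ <;> rw [h1] at hkh ⊢ <;>
    rw [h2, h3] <;> linarith [le_abs_self k, neg_abs_le k]

theorem hsigma_fekete_szego_large (lam t : ℝ) (hlam : 0 ≤ lam)
    (ht : t ∈ Set.Ioc (Real.sqrt 2 / 2) 1)
    (hne : 4 * (1 + lam) * t ^ 2 - (1 + lam) ^ 2 * (4 * t ^ 2 - 1) ≠ 0)
    (f : ℂ → ℂ) (hf : InHSigma lam t f)
    (a : ℕ → ℂ) (ha : ∀ n, a n = iteratedDeriv n f 0 / n.factorial)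
    (μ : ℝ)
    (hμ : |μ - 1| ≥ 1 / (8 * (1 + 2 * lam)) *
      |(1 + lam) ^ 2 / t ^ 2 - 4 * lam * (1 + lam)|) :
    ‖a 3 - (μ : ℂ) * (a 2) ^ 2‖ ≤ 8 * |1 - μ| * t ^ 3 /
      |4 * (1 + lam) * t ^ 2 - (1 + lam) ^ 2 * (4 * t ^ 2 - 1)| := by
  obtain ⟨g, hfg, hsf, hsg⟩ := hf
  have ht0 : 0 < t := lt_of_le_of_lt (by positivity) ht.1
  obtain ⟨hg0, hg1, hg2, hg3⟩ := hfg.inverse_coeff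
  have ha2 : iteratedDeriv 2 f 0 / 2 = a 2 := by simp [ha]
  have ha3 : iteratedDeriv 3 f 0 / 6 = a 3 := by simp [ha, Nat.factorial]
  rw [ha2] at hg2 hg3
  rw [ha3] at hg3
  obtain ⟨c, u, hu, hc, hcu⟩ :=
    hsf.exists_coeff (hfg.1 0 zero_mem_unitD) hfg.2.1 hfg.2.2.1 ha2 ha3
  obtain ⟨d, v, hv, hd, hdv⟩ :=
    hsg.exists_coeff (hfg.2.2.2.2.1 0 zero_mem_unitD) hg0 hg1 hg2 hg3
  set B : ℝ := 4 * (1 + lam) * t ^ 2 - (1 + lam) ^ 2 * (4 * t ^ 2 - 1) with hB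
  have htC : (t : ℂ) ≠ 0 := by exact_mod_cast ht0.ne'
  have hlC : (1 + 2 * lam : ℂ) ≠ 0 := by exact_mod_cast (by positivity : 1 + 2 * lam ≠ 0)
  have hBC : (B : ℂ) ≠ 0 := by exact_mod_cast hne
  have hdc : d = -c := mul_left_cancel₀ (mul_ne_zero two_ne_zero htC) (by linear_combination hd + hc)
  rw [hdc] at hdv
  have hsq : (a 2) ^ 2 * B = 4 * t ^ 3 * (u + v) := by
    rw [hB]
    push_cast
    linear_combination (-2 * (t : ℂ) ^ 2) * (hcu + hdv) +
      (4 * (t : ℂ) ^ 2 - 1) * (2 * t * c + (1 + lam) * a 2) * hc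
  have hdiff : 2 * (1 + 2 * lam) * (a 3 - (a 2) ^ 2) = t * (u - v) := by
    linear_combination (hdv - hcu) / 2
  have hrep : a 3 - (μ : ℂ) * (a 2) ^ 2 =
      ((4 * (1 - μ) * t ^ 3 / B : ℝ) : ℂ) * (u + v) +
        ((t / (2 * (1 + 2 * lam)) : ℝ) : ℂ) * (u - v) := by
    have h1 : (a 2) ^ 2 = 4 * t ^ 3 * (u + v) / B := by rw [← hsq]; field_simp
    have h2 : a 3 - (a 2) ^ 2 = t * (u - v) / (2 * (1 + 2 * lam)) := by
      rw [← hdiff]; field_simp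
    push_cast
    linear_combination h2 + (1 - μ) * h1
  have hkh : |t / (2 * (1 + 2 * lam))| ≤ |4 * (1 - μ) * t ^ 3 / B| := by
    have hBt : (1 + lam) ^ 2 / t ^ 2 - 4 * lam * (1 + lam) = B / t ^ 2 := by
      rw [hB]; field_simp; ring
    rw [hBt, abs_div, abs_of_pos (by positivity : 0 < t ^ 2), abs_sub_comm, ge_iff_le,
      div_mul_div_comm, one_mul, div_le_iff₀ (by positivity)] at hμ
    rw [abs_of_pos (by positivity), abs_div, abs_mul, abs_mul,
      abs_of_pos (by positivity : 0 < t ^ 3), abs_of_pos (by norm_num : (0 : ℝ) < 4),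
      div_le_div_iff₀ (by positivity) (abs_pos.2 hne)]
    nlinarith [mul_le_mul_of_nonneg_left hμ ht0.le]
  rw [hrep]
  refine (norm_mul_add_add_mul_sub_le hkh hu hv).trans (le_of_eq ?_)
  rw [abs_div, abs_mul, abs_mul, abs_of_pos (by positivity : 0 < t ^ 3),
    abs_of_pos (by norm_num : (0 : ℝ) < 4)]
  ring
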